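/- Let φ be a monotonic nonessential enhancement of site percolation on the square lattice ℤ². Then there exists a constant c₁ ∈ (0,∞), depending only on the enhancement, such that for every s ∈ [0,1] and every p ∈ (p_c, 1]: θ(p) ≤ θ(p,s) ≤ c₁ · θ(p). -/

import Mathlib

open MeasureTheory Filter Set Topology
open scoped ENNReal

namespace PercEnh

/-- Sites of the lattice (vertex set `ℤ²`). -/
abbrev Site : Type := ℤ × ℤ

/-- A configuration: the set of open sites. -/
abbrev Config : Type := Set Site

/-- Square-lattice (`ℤ²`-) adjacency: `‖x − y‖₁ = 1`. -/
def adjZ2 (x y : Site) : Prop := |x.1 - y.1| + |x.2 - y.2| = 1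

/-- Matching (star) adjacency: `x ≠ y` and `‖x − y‖_∞ = 1`. -/
def adjStar (x y : Site) : Prop := x ≠ y ∧ max |x.1 - y.1| |x.2 - y.2| = 1

/-- Euclidean norm of a site. -/
noncomputable def siteNorm (x : Site) : ℝ := Real.sqrt ((x.1 : ℝ) ^ 2 + (x.2 : ℝ) ^ 2)

/-- Sites in the closed Euclidean ball of radius `r` centred at the origin. -/
def siteBall (r : ℝ) : Set Site := {x | siteNorm x ≤ r}

/-- The shifted configuration `τ_x ω = {y − x : y ∈ ω}`. -/
def shiftConfig (x : Site) (ω : Config) : Config := {y | y + x ∈ ω}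

/-- An enhancement function of (finite) range `R₀`: takes values in subsets of
`𝔹₀ = ℤ² ∩ B(R₀)` and depends only on the restriction of the configuration to `𝔹₀`. -/
def IsEnhancement (R₀ : ℝ) (φ : Config → Config) : Prop :=
  0 ≤ R₀ ∧ (∀ ω, φ ω ⊆ siteBall R₀) ∧
    ∀ ω ω' : Config, ω ∩ siteBall R₀ = ω' ∩ siteBall R₀ → φ ω = φ ω'

/-- A monotonic enhancement function. -/
def Monotonic (φ : Config → Config) : Prop := ∀ ω ω' : Config, ω ⊆ ω' → φ ω ⊆ φ ω'

/-- The translate `φ_x(ω) = x + φ₀(τ_x ω)`. -/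
def enhAt (φ : Config → Config) (x : Site) (ω : Config) : Config :=
  (fun z => z + x) '' φ (shiftConfig x ω)

/-- The enhanced configuration `ω̂(ω, α) = ω ∪ ⋃_{x : α(x)=1} φ_x(ω)`. -/
def enhanced (φ : Config → Config) (ω : Config) (α : Site → Bool) : Config :=
  ω ∪ {y | ∃ x, α x = true ∧ y ∈ enhAt φ x ω}

/-- The fully (deterministically, with `s = 1`) enhanced configuration `ω̃`. -/
def fullyEnhanced (φ : Config → Config) (ω : Config) : Config :=
  ω ∪ {y | ∃ x, y ∈ enhAt φ x ω}

/-- `ω` contains a doubly-infinite self-repelling path (w.r.t. adjacency `adj`):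
a two-sided sequence of distinct sites of `ω` in which exactly the consecutive
pairs are adjacent. -/
def HasDISRPath (adj : Site → Site → Prop) (ω : Config) : Prop :=
  ∃ γ : ℤ → Site, Function.Injective γ ∧ (∀ i, γ i ∈ ω) ∧
    ∀ i j : ℤ, adj (γ i) (γ j) ↔ (j = i + 1 ∨ i = j + 1)

/-- The enhancement is essential: some configuration without a doubly-infinite
self-repelling path acquires one upon enhancement at the origin. -/
def Essential (adj : Site → Site → Prop) (φ : Config → Config) : Prop :=
  ∃ ω : Config, ¬ HasDISRPath adj ω ∧ HasDISRPath adj (ω ∪ φ ω)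

/-- A (finite, nonempty) path w.r.t. adjacency `adj`: distinct sites,
consecutive ones adjacent. -/
def IsPathOn (adj : Site → Site → Prop) (l : List Site) : Prop :=
  l ≠ [] ∧ l.Nodup ∧ l.Chain' adj

/-- `x` and `y` are joined by a path of sites of `ω`. -/
def ConnectedIn (adj : Site → Site → Prop) (ω : Config) (x y : Site) : Prop :=
  ∃ l : List Site, IsPathOn adj l ∧ (∀ z ∈ l, z ∈ ω) ∧
    l.head? = some x ∧ l.getLast? = some y

/-- `x` belongs to an infinite open cluster of `ω`. -/
def InInfiniteCluster (adj : Site → Site → Prop) (ω : Config) (x : Site) : Prop :=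
  {y | ConnectedIn adj ω x y}.Infinite

/-- `ω` contains an infinite open cluster. -/
def HasInfiniteCluster (adj : Site → Site → Prop) (ω : Config) : Prop :=
  ∃ x, InInfiniteCluster adj ω x

/-- The configuration corresponding to `η : Site → Bool`. -/
def toConfig (η : Site → Bool) : Config := {x | η x = true}

/-- A cylinder event. -/
def cylinder (F : Finset Site) (b : Site → Bool) : Set (Site → Bool) :=
  {η | ∀ x ∈ F, η x = b x}

/-- `μ` is the Bernoulli product measure with density `p` of open sites. -/
def IsBernoulli (p : ℝ) (μ : Measure (Site → Bool)) : Prop :=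
  IsProbabilityMeasure μ ∧
    ∀ (F : Finset Site) (b : Site → Bool),
      μ (cylinder F b) = ∏ x ∈ F, ENNReal.ofReal (if b x then p else 1 - p)

/-- The percolation probability `θ`: the probability that the origin lies in an
infinite open cluster. -/
noncomputable def theta (adj : Site → Site → Prop) (μ : Measure (Site → Bool)) : ℝ :=
  (μ {η | InInfiniteCluster adj (toConfig η) 0}).toReal

/-- The percolation probability of the enhanced process (`μ` the law of the
configuration, `ν` the law of the activation variables). -/
noncomputable def thetaEnh (adj : Site → Site → Prop) (φ : Config → Config)
    (μ ν : Measure (Site → Bool)) : ℝ :=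
  ((μ.prod ν) {ηα | InInfiniteCluster adj (enhanced φ (toConfig ηα.1) ηα.2) 0}).toReal

/-- The critical point `p_c = sup {p ∈ [0,1] : θ(p) = 0}` for the family `P`. -/
noncomputable def pcOf (adj : Site → Site → Prop) (P : ℝ → Measure (Site → Bool)) : ℝ :=
  sSup {p | p ∈ Icc (0:ℝ) 1 ∧ theta adj (P p) = 0}

/-- The connectivity function `τ_p(x)`. -/
noncomputable def tau (adj : Site → Site → Prop) (μ : Measure (Site → Bool)) (x : Site) : ℝ :=
  (μ {η | ConnectedIn adj (toConfig η) 0 x}).toReal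

/-- The connectivity function `τ_{p,s}(x)` of the enhanced process. -/
noncomputable def tauEnh (adj : Site → Site → Prop) (φ : Config → Config)
    (μ ν : Measure (Site → Bool)) (x : Site) : ℝ :=
  ((μ.prod ν) {ηα | ConnectedIn adj (enhanced φ (toConfig ηα.1) ηα.2) 0 x}).toReal

/-- The mean cluster size `χ(p) = E_p‖C‖ = ∑_x τ_p(x)`. -/
noncomputable def chi (adj : Site → Site → Prop) (μ : Measure (Site → Bool)) : ℝ≥0∞ :=
  ∑' x : Site, μ {η | ConnectedIn adj (toConfig η) 0 x}

/-- The mean cluster size of the enhanced process. -/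
noncomputable def chiEnh (adj : Site → Site → Prop) (φ : Config → Config)
    (μ ν : Measure (Site → Bool)) : ℝ≥0∞ :=
  ∑' x : Site, (μ.prod ν) {ηα | ConnectedIn adj (enhanced φ (toConfig ηα.1) ηα.2) 0 x}

lemma adjZ2_iff {x y : Site} : adjZ2 x y ↔
    (x.1 = y.1 ∧ (x.2 = y.2 + 1 ∨ y.2 = x.2 + 1)) ∨
      (x.2 = y.2 ∧ (x.1 = y.1 + 1 ∨ y.1 = x.1 + 1)) := by
  unfold adjZ2
  rcases abs_cases (x.1 - y.1) with h | h <;> rcases abs_cases (x.2 - y.2) with h' | h' <;> omega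

lemma adjZ2.symm {x y : Site} (h : adjZ2 x y) : adjZ2 y x := by
  rw [adjZ2_iff] at *; omega

/-- The square box of radius `L` centred at `c`. -/
def box (L : ℤ) (c : Site) : Set Site :=
  {x | c.1 - L ≤ x.1 ∧ x.1 ≤ c.1 + L ∧ c.2 - L ≤ x.2 ∧ x.2 ≤ c.2 + L}

lemma mem_box {L : ℤ} {c x : Site} : x ∈ box L c ↔
    c.1 - L ≤ x.1 ∧ x.1 ≤ c.1 + L ∧ c.2 - L ≤ x.2 ∧ x.2 ≤ c.2 + L := Iff.rfl

lemma box_finite (L : ℤ) (c : Site) : (box L c).Finite := by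
  refine ((Set.finite_Icc (c.1 - L) (c.1 + L)).prod
    (Set.finite_Icc (c.2 - L) (c.2 + L))).subset ?_
  rintro x ⟨h1, h2, h3, h4⟩
  exact ⟨⟨h1, h2⟩, h3, h4⟩

lemma mem_box_comm {L : ℤ} {c x : Site} : x ∈ box L c ↔ c ∈ box L x := by
  simp only [mem_box]; omega

lemma siteBall_subset_box {r : ℝ} : siteBall r ⊆ box ⌈r⌉₊ 0 := by
  intro x hx
  have hx' : siteNorm x ≤ r := hx
  have hr : r ≤ (⌈r⌉₊ : ℝ) := Nat.le_ceil r
  have h1 : |(x.1 : ℝ)| ≤ siteNorm x := Real.abs_le_sqrt (by nlinarith [sq_nonneg (x.2 : ℝ)])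
  have h2 : |(x.2 : ℝ)| ≤ siteNorm x := Real.abs_le_sqrt (by nlinarith [sq_nonneg (x.1 : ℝ)])
  have h1' := abs_le.1 (h1.trans (hx'.trans hr))
  have h2' := abs_le.1 (h2.trans (hx'.trans hr))
  simp only [mem_box, Prod.fst_zero, Prod.snd_zero, zero_sub, zero_add]
  exact ⟨by exact_mod_cast h1'.1, by exact_mod_cast h1'.2, by exact_mod_cast h2'.1,
    by exact_mod_cast h2'.2⟩

/-- The direction pointing straight out of the box of radius `L` at the site `a`. -/
def outDir (L : ℤ) (a : Site) : Site :=
  if L < a.1 then (1, 0) else if a.1 < -L then (-1, 0) else if L < a.2 then (0, 1) else (0, -1)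

/-- The `n`-th site of the straight ray that leaves the box of radius `L` at `a`. -/
def rayPt (L : ℤ) (a : Site) (n : ℤ) : Site :=
  (a.1 + n * (outDir L a).1, a.2 + n * (outDir L a).2)

/-- The sites on the outer boundary of the box of radius `L`. -/
def outerBoundary (L : ℤ) : Set Site := {a | a ∉ box L 0 ∧ ∃ u ∈ box L 0, adjZ2 a u}

lemma rayPt_cases {L : ℤ} {a : Site} (ha : a ∈ outerBoundary L) :
    ((∀ n, rayPt L a n = (a.1 + n, a.2)) ∧ a.1 = L + 1 ∧ -L ≤ a.2 ∧ a.2 ≤ L) ∨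
    ((∀ n, rayPt L a n = (a.1 - n, a.2)) ∧ a.1 = -L - 1 ∧ -L ≤ a.2 ∧ a.2 ≤ L) ∨
    ((∀ n, rayPt L a n = (a.1, a.2 + n)) ∧ a.2 = L + 1 ∧ -L ≤ a.1 ∧ a.1 ≤ L) ∨
    ((∀ n, rayPt L a n = (a.1, a.2 - n)) ∧ a.2 = -L - 1 ∧ -L ≤ a.1 ∧ a.1 ≤ L) := by
  obtain ⟨h, u, hu, hau⟩ := ha
  rw [adjZ2_iff] at hau
  simp only [mem_box, Prod.fst_zero, Prod.snd_zero, zero_sub, zero_add] at h hu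
  unfold rayPt outDir
  split_ifs with h1 h2 h3
  · left; exact ⟨fun n => by simp, by omega⟩
  · right; left; exact ⟨fun n => by simp [sub_eq_add_neg], by omega⟩
  · right; right; left; exact ⟨fun n => by simp, by omega⟩
  · right; right; right; exact ⟨fun n => by simp [sub_eq_add_neg], by omega⟩

lemma rayPt_zero (L : ℤ) (a : Site) : rayPt L a 0 = a := by simp [rayPt]

lemma rayPt_notMem_box {L : ℤ} {a : Site} (ha : a ∈ outerBoundary L) {n : ℤ} (hn : 0 ≤ n) :
    rayPt L a n ∉ box L 0 := by
  simp only [mem_box, Prod.fst_zero, Prod.snd_zero, zero_sub, zero_add]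
  rcases rayPt_cases ha with h | h | h | h <;> rw [h.1] <;> dsimp only <;> omega

lemma eq_zero_of_rayPt_adj_box {L : ℤ} {a : Site} (ha : a ∈ outerBoundary L) {n : ℤ} (hn : 0 ≤ n)
    {u : Site} (hu : u ∈ box L 0) (h : adjZ2 (rayPt L a n) u) : n = 0 := by
  rw [adjZ2_iff] at h
  simp only [mem_box, Prod.fst_zero, Prod.snd_zero, zero_sub, zero_add] at hu
  rcases rayPt_cases ha with h' | h' | h' | h' <;> rw [h'.1] at h <;> dsimp only at h <;> omega

lemma adj_rayPt_iff {L : ℤ} {a : Site} (ha : a ∈ outerBoundary L) {n m : ℤ} :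
    adjZ2 (rayPt L a n) (rayPt L a m) ↔ (m = n + 1 ∨ n = m + 1) := by
  rw [adjZ2_iff]
  rcases rayPt_cases ha with h | h | h | h <;> rw [h.1, h.1] <;> dsimp only <;> omega

lemma rayPt_inj {L : ℤ} {a : Site} (ha : a ∈ outerBoundary L) {n m : ℤ} :
    rayPt L a n = rayPt L a m ↔ n = m := by
  rw [Prod.ext_iff]
  rcases rayPt_cases ha with h | h | h | h <;> rw [h.1, h.1] <;> dsimp only <;> omega

lemma rayPt_separated {L : ℤ} {a b : Site} (ha : a ∈ outerBoundary L) (hb : b ∈ outerBoundary L)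
    (hab : a ≠ b) (hadj : ¬ adjZ2 a b) {n m : ℤ} (hn : 0 ≤ n) (hm : 0 ≤ m) :
    rayPt L a n ≠ rayPt L b m ∧ ¬ adjZ2 (rayPt L a n) (rayPt L b m) := by
  rw [Ne, Prod.ext_iff] at hab ⊢
  rw [adjZ2_iff] at hadj ⊢
  rcases rayPt_cases ha with h | h | h | h <;> rcases rayPt_cases hb with h' | h' | h' | h' <;>
    rw [h.1, h'.1] <;> dsimp only <;> omega

lemma exists_eq_of_le_of_injective {f : ℕ → ℕ} (hf : Function.Injective f)
    (hstep : ∀ n, f (n + 1) ≤ f n + 1) {m : ℕ} (hm : f 0 ≤ m) : ∃ n, f n = m := by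
  classical
  have hex : ∃ n, m ≤ f n := by
    by_contra! h
    exact Set.infinite_of_injective_forall_mem hf (fun n => (h n : f n ∈ Set.Iio m))
      (Set.finite_Iio m)
  refine ⟨Nat.find hex, ?_⟩
  have h1 := Nat.find_spec hex
  rcases hk : Nat.find hex with _ | k
  · rw [hk] at h1; omega
  · have h2 := Nat.find_min hex (m := k) (by omega)
    have := hstep k
    rw [hk] at h1; omega

/-- A doubly-infinite path cannot have both its ends in the same ray. -/
lemma not_subset_finite_union_ray {L : ℤ} {a : Site} (ha : a ∈ outerBoundary L) {F : Set Site}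
    (hF : F.Finite) {δ : ℤ → Site} (hδ : Function.Injective δ)
    (hadj : ∀ i, adjZ2 (δ i) (δ (i + 1)))
    (hmem : ∀ i, δ i ∈ F ∨ ∃ n : ℕ, δ i = rayPt L a n) : False := by
  have hfin : (δ ⁻¹' F).Finite := hF.preimage hδ.injOn
  obtain ⟨M, hM⟩ := hfin.bddAbove
  obtain ⟨M', hM'⟩ := hfin.bddBelow
  have hp : ∀ k : ℕ, ∃ n : ℕ, δ (max M 0 + 1 + k) = rayPt L a n := fun k =>
    (hmem _).resolve_left fun h => by have := hM h; omega
  have hq : ∀ k : ℕ, ∃ n : ℕ, δ (min M' 0 - 1 - k) = rayPt L a n := fun k =>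
    (hmem _).resolve_left fun h => by have := hM' h; omega
  choose f hf using hp
  choose g hg using hq
  have hfi : Function.Injective f := fun k l h => by
    have : δ (max M 0 + 1 + k) = δ (max M 0 + 1 + l) := by rw [hf, hf, h]
    have := hδ this
    omega
  have hgi : Function.Injective g := fun k l h => by
    have : δ (min M' 0 - 1 - k) = δ (min M' 0 - 1 - l) := by rw [hg, hg, h]
    have := hδ this
    omega
  have hfs : ∀ k, f (k + 1) ≤ f k + 1 := fun k => by
    have h := hadj (max M 0 + 1 + k)
    rw [show max M 0 + 1 + (k : ℤ) + 1 = max M 0 + 1 + ((k + 1 : ℕ) : ℤ) by push_cast; ring,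
      hf, hf, adj_rayPt_iff ha] at h
    omega
  have hgs : ∀ k, g (k + 1) ≤ g k + 1 := fun k => by
    have h := hadj (min M' 0 - 1 - ((k + 1 : ℕ) : ℤ))
    rw [show min M' 0 - 1 - ((k + 1 : ℕ) : ℤ) + 1 = min M' 0 - 1 - (k : ℤ) by push_cast; ring,
      hg, hg, adj_rayPt_iff ha] at h
    omega
  obtain ⟨k, hk⟩ := exists_eq_of_le_of_injective hfi hfs (le_max_left (f 0) (g 0))
  obtain ⟨l, hl⟩ := exists_eq_of_le_of_injective hgi hgs (le_max_right (f 0) (g 0))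
  have : δ (max M 0 + 1 + k) = δ (min M' 0 - 1 - l) := by rw [hf, hg, hk, hl]
  have := hδ this
  omega

/-- The doubly-infinite path made of the finite path `c 0, …, c n` and the two rays
leaving the box at its end points. -/
def extendByRays (L : ℤ) (n : ℕ) (c : ℕ → Site) (i : ℤ) : Site :=
  if i < 0 then rayPt L (c 0) (-i) else if i ≤ n then c i.toNat else rayPt L (c n) (i - n)

/-- A self-repelling crossing of the box extends to a doubly-infinite self-repelling path. -/
lemma hasDISRPath_of_crossing {L : ℤ} {n : ℕ} {c : ℕ → Site} {ζ : Config} (hn : 2 ≤ n)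
    (h0 : c 0 ∈ outerBoundary L) (h1 : c n ∈ outerBoundary L)
    (hin : ∀ i, 0 < i → i < n → c i ∈ box L 0)
    (hadj : ∀ i < n, adjZ2 (c i) (c (i + 1)))
    (hne : ∀ i j, i < j → j ≤ n → c i ≠ c j)
    (hsr : ∀ i j, i + 1 < j → j ≤ n → ¬ adjZ2 (c i) (c j))
    (hζ : ∀ i ≤ n, c i ∈ ζ) (hr0 : ∀ k : ℕ, rayPt L (c 0) k ∈ ζ)
    (hr1 : ∀ k : ℕ, rayPt L (c n) k ∈ ζ) : HasDISRPath adjZ2 ζ := by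
  have key : ∀ i j : ℤ, i < j → extendByRays L n c i ≠ extendByRays L n c j ∧
      (adjZ2 (extendByRays L n c i) (extendByRays L n c j) ↔ j = i + 1) := by
    have hends := hne 0 n (by omega) le_rfl
    have hends' := hsr 0 n (by omega) le_rfl
    intro i j hij
    have hz0 := rayPt_zero L (c 0)
    have hz1 := rayPt_zero L (c n)
    have hsep {k l : ℤ} (hk : 0 ≤ k) (hl : 0 ≤ l) :=
      rayPt_separated h0 h1 hends hends' hk hl
    have hbox {a : Site} (ha : a ∈ outerBoundary L) {k : ℤ} (hk : 0 < k) {u : Site}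
        (hu : u ∈ box L 0) : rayPt L a k ≠ u ∧ ¬ adjZ2 (rayPt L a k) u :=
      ⟨fun h => rayPt_notMem_box ha hk.le (h ▸ hu),
        fun h => hk.ne' (eq_zero_of_rayPt_adj_box ha hk.le hu h)⟩
    by_cases hi : i < 0
    · rw [extendByRays, if_pos hi]
      unfold extendByRays
      split_ifs with hj hj'
      · rw [Ne, rayPt_inj h0, adj_rayPt_iff h0]; omega
      · lift j to ℕ using by omega
        simp only [Int.toNat_natCast]
        rcases Nat.eq_zero_or_pos j with rfl | hj0
        · have e1 := rayPt_inj h0 (n := -i) (m := 0)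
          have e2 := adj_rayPt_iff h0 (n := -i) (m := 0)
          rw [hz0] at e1 e2
          rw [Ne, e1, e2]; omega
        · rcases eq_or_ne j n with rfl | hjn
          · have := hsep (k := -i) (l := 0) (by omega) le_rfl
            rw [hz1] at this
            exact ⟨this.1, iff_of_false this.2 (by omega)⟩
          · have := hbox h0 (k := -i) (by omega) (hin j hj0 (by omega))
            exact ⟨this.1, iff_of_false this.2 (by omega)⟩
      · have := hsep (k := -i) (l := j - n) (by omega) (by omega)
        exact ⟨this.1, iff_of_false this.2 (by omega)⟩
    · lift i to ℕ using by omega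
      lift j to ℕ using by omega
      by_cases hin' : (i : ℤ) ≤ n
      · rw [extendByRays, if_neg hi, if_pos hin', extendByRays, if_neg (by omega)]
        simp only [Int.toNat_natCast]
        split_ifs with hj'
        · refine ⟨hne i j (by omega) (by omega), ?_⟩
          rcases eq_or_ne j (i + 1) with rfl | hji
          · exact iff_of_true (hadj i (by omega)) (by omega)
          · exact iff_of_false (hsr i j (by omega) (by omega)) (by omega)
        · rcases Nat.eq_zero_or_pos i with rfl | hi0
          · have := hsep (k := 0) (l := j - n) le_rfl (by omega)
            rw [hz0] at this
            exact ⟨this.1, iff_of_false this.2 (by omega)⟩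
          · rcases eq_or_ne i n with rfl | hin''
            · have e1 := rayPt_inj h1 (n := 0) (m := j - i)
              have e2 := adj_rayPt_iff h1 (n := 0) (m := j - i)
              rw [hz1] at e1 e2
              rw [Ne, e1, e2]; omega
            · have := hbox h1 (k := j - n) (by omega) (hin i hi0 (by omega))
              exact ⟨this.1.symm, iff_of_false (fun h => this.2 h.symm) (by omega)⟩
      · rw [extendByRays, if_neg hi, if_neg hin', extendByRays, if_neg (by omega),
          if_neg (by omega), Ne, rayPt_inj h1, adj_rayPt_iff h1]
        omega
  refine ⟨extendByRays L n c, ?_, ?_, ?_⟩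
  · intro i j h
    rcases lt_trichotomy i j with hij | hij | hij
    · exact absurd h (key i j hij).1
    · exact hij
    · exact absurd h.symm (key j i hij).1
  · intro i
    unfold extendByRays
    split_ifs with h h'
    · obtain ⟨k, hk⟩ := Int.eq_ofNat_of_zero_le (a := -i) (by omega)
      rw [hk]; exact hr0 k
    · exact hζ _ (by omega)
    · obtain ⟨k, hk⟩ := Int.eq_ofNat_of_zero_le (a := i - n) (by omega)
      rw [hk]; exact hr1 k
  · intro i j
    rcases lt_trichotomy i j with hij | hij | hij
    · rw [(key i j hij).2]; omega
    · subst hij; rw [adjZ2_iff]; omega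
    · rw [show adjZ2 (extendByRays L n c i) (extendByRays L n c j) ↔
        adjZ2 (extendByRays L n c j) (extendByRays L n c i) from ⟨adjZ2.symm, adjZ2.symm⟩,
        (key j i hij).2]
      omega

/-- A doubly-infinite path inside the box and the two rays joins the two rays through the box. -/
lemma false_of_separating {L : ℤ} {a b : Site} (ha : a ∈ outerBoundary L)
    (hb : b ∈ outerBoundary L) (hab : a ≠ b) (hnadj : ¬ adjZ2 a b) {ω C : Config}
    (hC : ∀ u ∈ C, ∀ v ∈ ω, adjZ2 u v → v ∈ C) (haC : a ∈ C) (hbω : b ∈ ω) (hbC : b ∉ C)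
    {δ : ℤ → Site} (hδ : Function.Injective δ) (hadj : ∀ i, adjZ2 (δ i) (δ (i + 1)))
    (hmem : ∀ i, δ i ∈ (ω ∩ box L 0) ∪
      ({x | ∃ n : ℕ, x = rayPt L a n} ∪ {x | ∃ n : ℕ, x = rayPt L b n})) : False := by
  set ζ : Config := (ω ∩ box L 0) ∪
      ({x | ∃ n : ℕ, x = rayPt L a n} ∪ {x | ∃ n : ℕ, x = rayPt L b n}) with hζ
  set S : Config := (C ∩ box L 0) ∪ {x | ∃ n : ℕ, x = rayPt L a n} with hS
  have hclosed : ∀ u ∈ S, ∀ v ∈ ζ, adjZ2 u v → v ∈ S := by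
    rintro u (⟨huC, hub⟩ | ⟨k, rfl⟩) v (⟨hvω, hvb⟩ | hv | ⟨l, rfl⟩) huv
    · exact Or.inl ⟨hC u huC v hvω huv, hvb⟩
    · exact Or.inr hv
    · have h0 := eq_zero_of_rayPt_adj_box hb (Int.natCast_nonneg l) hub huv.symm
      rw [h0, rayPt_zero] at huv
      exact absurd (hC u huC b hbω huv) hbC
    · have h0 := eq_zero_of_rayPt_adj_box ha (Int.natCast_nonneg k) hvb huv
      rw [h0, rayPt_zero] at huv
      exact Or.inl ⟨hC a haC v hvω huv, hvb⟩
    · exact Or.inr hv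
    · exact absurd huv (rayPt_separated ha hb hab hnadj (Int.natCast_nonneg k)
        (Int.natCast_nonneg l)).2
  have hiff : ∀ i, δ i ∈ S ↔ δ (i + 1) ∈ S := fun i =>
    ⟨fun h => hclosed _ h _ (hmem _) (hadj i), fun h => hclosed _ h _ (hmem _) (hadj i).symm⟩
  have hall : ∀ i, δ i ∈ S ↔ δ 0 ∈ S := fun i => by
    induction i using Int.induction_on with
    | zero => rfl
    | succ i ih => rw [← hiff]; exact ih
    | pred i ih => rw [hiff, sub_add_cancel]; exact ih
  by_cases h0 : δ 0 ∈ S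
  · refine not_subset_finite_union_ray ha (box_finite L 0) hδ hadj fun i => ?_
    rcases (hall i).2 h0 with h | h
    exacts [Or.inl h.2, Or.inr h]
  · refine not_subset_finite_union_ray hb (box_finite L 0) hδ hadj fun i => ?_
    rcases hmem i with h | h | h
    · exact Or.inl h.2
    · exact absurd ((hall i).1 (Or.inr h)) h0
    · exact Or.inr h

/-- A nonessential enhancement at the origin does not connect sites outside the box
that were not connected before. -/
lemma false_of_escape {L : ℤ} {φ : Config → Config} (hsub : ∀ ω, φ ω ⊆ box L 0)
    (hloc : ∀ ω ω' : Config, ω ∩ box L 0 = ω' ∩ box L 0 → φ ω = φ ω')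
    (hness : ¬ Essential adjZ2 φ) {ω C : Config}
    (hC : ∀ u ∈ C, ∀ v ∈ ω, adjZ2 u v → v ∈ C) {n : ℕ} {c : ℕ → Site}
    (hc : ∀ i ≤ n, c i ∈ ω ∪ φ ω) (hadj : ∀ i < n, adjZ2 (c i) (c (i + 1)))
    (h0 : c 0 ∈ C \ box L 0) (hn : c n ∉ C ∪ box L 0) : False := by
  classical
  let Q : ℕ → Prop := fun n => ∃ c : ℕ → Site, (∀ i ≤ n, c i ∈ ω ∪ φ ω) ∧
    (∀ i < n, adjZ2 (c i) (c (i + 1))) ∧ c 0 ∈ C \ box L 0 ∧ c n ∉ C ∪ box L 0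
  have hQ : ∃ n, Q n := ⟨n, c, hc, hadj, h0, hn⟩
  have hmin : ∀ m, m < Nat.find hQ → ¬ Q m := fun m => Nat.find_min hQ
  obtain ⟨c, hc, hadj, h0, hn⟩ := Nat.find_spec hQ
  generalize Nat.find hQ = n at hmin hc hadj hn
  clear hQ
  have hout : ∀ {x}, x ∈ ω ∪ φ ω → x ∉ box L 0 → x ∈ ω := fun hx hxb =>
    hx.resolve_right fun h => hxb (hsub _ h)
  have hn0 : n ≠ 0 := by
    rintro rfl; exact hn (Or.inl h0.1)
  have hnω : c n ∈ ω := hout (hc n le_rfl) fun h => hn (Or.inr h)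
  have hn1 : n ≠ 1 := by
    rintro rfl
    exact hn (Or.inl (hC _ h0.1 _ hnω (hadj 0 one_pos)))
  have hin : ∀ i, 0 < i → i < n → c i ∈ box L 0 := by
    intro i hi0 hin
    by_contra hib
    by_cases hiC : c i ∈ C
    · refine hmin (n - i) (by omega) ⟨fun k => c (i + k), fun k hk => hc _ (by omega),
        fun k hk => hadj (i + k) (by omega), ⟨hiC, hib⟩, ?_⟩
      rwa [← show i + (n - i) = n by omega] at hn
    · exact hmin i hin ⟨c, fun k hk => hc k (by omega), fun k hk => hadj k (by omega), h0,
        fun h => h.elim hiC hib⟩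
  have hcut : ∀ i d : ℕ, 0 < d → i + 1 + d ≤ n → ¬ adjZ2 (c i) (c (i + 1 + d)) := by
    intro i d hd hle hbad
    refine hmin (n - d) (by omega) ⟨fun k => if k ≤ i then c k else c (k + d), ?_, ?_, ?_, ?_⟩
    · intro k hk
      dsimp only
      split_ifs
      exacts [hc _ (by omega), hc _ (by omega)]
    · intro k hk
      dsimp only
      split_ifs with h1 h2 h2
      · exact hadj k (by omega)
      · obtain rfl : k = i := by omega
        exact hbad
      · omega
      · rw [show k + 1 + d = k + d + 1 by ring]; exact hadj _ (by omega)
    · simpa using h0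
    · dsimp only
      rw [if_neg (by omega), Nat.sub_add_cancel (by omega)]
      exact hn
  have hsr : ∀ i j, i + 1 < j → j ≤ n → ¬ adjZ2 (c i) (c j) := by
    intro i j hij hj
    have := hcut i (j - (i + 1)) (by omega) (by omega)
    rwa [show i + 1 + (j - (i + 1)) = j by omega] at this
  have hne : ∀ i j, i < j → j ≤ n → c i ≠ c j := by
    intro i j hij hj heq
    rcases eq_or_ne j n with rfl | hjn
    · rcases Nat.eq_zero_or_pos i with rfl | hi0
      · exact hn (Or.inl (heq ▸ h0.1))
      · exact hn (Or.inr (heq ▸ hin i hi0 hij))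
    · have := hadj j (by omega)
      rw [← heq] at this
      exact hsr i (j + 1) (by omega) (by omega) this
  have ha : c 0 ∈ outerBoundary L :=
    ⟨h0.2, c 1, hin 1 one_pos (by omega), hadj 0 (by omega)⟩
  have hb : c n ∈ outerBoundary L := by
    refine ⟨fun h => hn (Or.inr h), c (n - 1), hin _ (by omega) (by omega), ?_⟩
    have := hadj (n - 1) (by omega)
    rw [show n - 1 + 1 = n by omega] at this
    exact this.symm
  set ζ : Config := (ω ∩ box L 0) ∪
      ({x | ∃ k : ℕ, x = rayPt L (c 0) k} ∪ {x | ∃ k : ℕ, x = rayPt L (c n) k}) with hζ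
  have hφ : φ ζ = φ ω := by
    refine hloc _ _ (Set.ext fun x => ⟨?_, fun hx => ⟨Or.inl hx, hx.2⟩⟩)
    rintro ⟨hx | ⟨k, rfl⟩ | ⟨k, rfl⟩, hxb⟩
    · exact hx
    · exact absurd hxb (rayPt_notMem_box ha (Int.natCast_nonneg k))
    · exact absurd hxb (rayPt_notMem_box hb (Int.natCast_nonneg k))
  have hpath : HasDISRPath adjZ2 (ζ ∪ φ ζ) := by
    refine hasDISRPath_of_crossing (by omega) ha hb hin hadj hne hsr ?_
      (fun k => Or.inl (Or.inr (Or.inl ⟨k, rfl⟩))) (fun k => Or.inl (Or.inr (Or.inr ⟨k, rfl⟩)))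
    intro i hi
    rcases Nat.eq_zero_or_pos i with rfl | hi0
    · exact Or.inl (Or.inr (Or.inl ⟨0, by simp [rayPt_zero]⟩))
    · rcases eq_or_ne i n with rfl | hin'
      · exact Or.inl (Or.inr (Or.inr ⟨0, by simp [rayPt_zero]⟩))
      · rw [hφ]
        rcases hc i hi with h | h
        · exact Or.inl (Or.inl ⟨h, hin i hi0 (by omega)⟩)
        · exact Or.inr h
  obtain ⟨δ, hδ, hmem, hδadj⟩ := not_not.1 fun h => hness ⟨ζ, h, hpath⟩
  exact false_of_separating ha hb (hne 0 n (by omega) le_rfl) (hsr 0 n (by omega) le_rfl) hC h0.1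
    hnω (fun h => hn (Or.inl h)) hδ (fun i => (hδadj i (i + 1)).2 (Or.inl rfl)) hmem

/-- `y` is joined to `x` by a walk of sites of `ω`. -/
def Joined (ω : Config) (x y : Site) : Prop :=
  x ∈ ω ∧ Relation.ReflTransGen (fun u v => adjZ2 u v ∧ v ∈ ω) x y

lemma Joined.mono {ω ω' : Config} (hω : ω ⊆ ω') {x y : Site} (h : Joined ω x y) :
    Joined ω' x y :=
  ⟨hω h.1, Relation.ReflTransGen.mono (fun _ _ h => ⟨h.1, hω h.2⟩) _ _ h.2⟩

lemma Joined.mem_of_closed {ω S : Config} (hS : ∀ u ∈ S, ∀ v ∈ ω, adjZ2 u v → v ∈ S)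
    {x y : Site} (h : Joined ω x y) (hx : x ∈ S) : y ∈ S := by
  obtain ⟨-, h⟩ := h
  induction h with
  | refl => exact hx
  | tail _ h ih => exact hS _ ih _ h.2 h.1

lemma Joined.shift {ω : Config} {y z : Site} (x : Site) (h : Joined (shiftConfig x ω) y z) :
    Joined ω (y + x) (z + x) := by
  refine ⟨h.1, h.2.lift (· + x) fun u v huv => ⟨?_, huv.2⟩⟩
  have := huv.1
  rw [adjZ2_iff] at this ⊢
  simpa [add_right_comm _ x.1, add_right_comm _ x.2] using this

lemma Joined.exists_walk {ω : Config} {x y : Site} (h : Joined ω x y) :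
    ∃ (n : ℕ) (c : ℕ → Site), c 0 = x ∧ c n = y ∧ (∀ i ≤ n, c i ∈ ω) ∧
      ∀ i < n, adjZ2 (c i) (c (i + 1)) := by
  obtain ⟨hx, h⟩ := h
  induction h with
  | refl => exact ⟨0, fun _ => x, rfl, rfl, fun _ _ => hx, fun i hi => absurd hi (by omega)⟩
  | @tail u v _ h ih =>
    obtain ⟨n, c, h0, hn, hc, hadj⟩ := ih
    refine ⟨n + 1, fun k => if k ≤ n then c k else v, by simpa using h0, by simp, ?_, ?_⟩
    · intro i _
      dsimp only
      split_ifs with h'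
      exacts [hc i h', h.2]
    · intro i hi
      dsimp only
      rw [if_pos (by omega)]
      split_ifs with h'
      · exact hadj i (by omega)
      · obtain rfl : i = n := by omega
        rw [hn]; exact h.1

lemma joined_iff_connectedIn {ω : Config} {x y : Site} :
    Joined ω x y ↔ ConnectedIn adjZ2 ω x y := by
  constructor
  · rintro ⟨hx, h⟩
    induction h with
    | refl =>
      exact ⟨[x], ⟨by simp, by simp, List.isChain_singleton x⟩, by simpa using hx, by simp, by simp⟩
    | @tail u v _ h ih =>
      obtain ⟨l, ⟨hl0, hl1, hl2⟩, hlω, hlx, hlu⟩ := ih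
      by_cases hv : v ∈ l
      · obtain ⟨l₁, l₂, rfl⟩ := List.append_of_mem hv
        have hpre : l₁ ++ [v] <+: l₁ ++ v :: l₂ := ⟨l₂, by simp⟩
        refine ⟨l₁ ++ [v], ⟨by simp, hl1.sublist hpre.sublist, ?_⟩,
          fun z hz => hlω z (hpre.subset hz), ?_, by simp⟩
        · exact List.IsChain.prefix hl2 hpre
        · rw [← hlx]; cases l₁ <;> simp
      · refine ⟨l ++ [v], ⟨by simp, ?_, ?_⟩, ?_, ?_, by simp⟩
        · rw [List.nodup_append]
          refine ⟨hl1, by simp, ?_⟩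
          rintro a ha b hb rfl
          rw [List.mem_singleton] at hb
          exact hv (hb ▸ ha)
        · refine List.IsChain.append hl2 (by simp) ?_
          intro a ha b hb
          rw [hlu] at ha
          simp only [List.head?_cons, Option.mem_def, Option.some.injEq] at ha hb
          rw [← ha, ← hb]; exact h.1
        · intro z hz
          rcases List.mem_append.1 hz with hz | hz
          · exact hlω z hz
          · rw [List.mem_singleton.1 hz]; exact h.2
        · rw [List.head?_append, hlx]; rfl
  · rintro ⟨l, ⟨-, -, hch⟩, hlω, hlx, hly⟩
    induction l generalizing x with
    | nil => simp at hlx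
    | cons a l ih =>
      obtain rfl : a = x := by simpa using hlx
      cases l with
      | nil =>
        obtain rfl : a = y := by simpa using hly
        exact ⟨hlω a (by simp), .refl⟩
      | cons b l =>
        have hch' := List.isChain_cons_cons.1 hch
        have := ih (x := b) hch'.2 (fun z hz => hlω z (by simp [hz])) (by simp) (by simpa using hly)
        exact ⟨hlω a (by simp), .head ⟨hch'.1, this.1⟩ this.2⟩

lemma shiftConfig_neg_shiftConfig (x : Site) (ω : Config) :
    shiftConfig (-x) (shiftConfig x ω) = ω := by
  ext y; simp [shiftConfig]

lemma shiftConfig_union_enhAt (φ : Config → Config) (x : Site) (ω : Config) :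
    shiftConfig x (ω ∪ enhAt φ x ω) = shiftConfig x ω ∪ φ (shiftConfig x ω) := by
  ext y; simp [shiftConfig, enhAt]

lemma Joined.shift_sub {ω : Config} {y z : Site} (x : Site) (h : Joined ω y z) :
    Joined (shiftConfig x ω) (y - x) (z - x) := by
  rw [← shiftConfig_neg_shiftConfig x ω] at h
  simpa [sub_eq_add_neg] using h.shift (-x)

lemma enhAt_mono {φ : Config → Config} (hmono : Monotonic φ) (x : Site) {ω ω' : Config}
    (h : ω ⊆ ω') : enhAt φ x ω ⊆ enhAt φ x ω' :=
  Set.image_mono (hmono _ _ fun _ hy => h hy)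

lemma enhAt_subset_box {L : ℤ} {φ : Config → Config} (hsub : ∀ ω, φ ω ⊆ box L 0) (x : Site)
    (ω : Config) : enhAt φ x ω ⊆ box L x := by
  rintro _ ⟨z, hz, rfl⟩
  have := hsub _ hz
  simp only [mem_box, Prod.fst_zero, Prod.snd_zero, Prod.fst_add, Prod.snd_add] at this ⊢
  omega

section Deterministic

variable {L : ℤ} {φ : Config → Config}

lemma Joined.of_union_enhAt (hsub : ∀ ω, φ ω ⊆ box L 0)
    (hloc : ∀ ω ω' : Config, ω ∩ box L 0 = ω' ∩ box L 0 → φ ω = φ ω')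
    (hness : ¬ Essential adjZ2 φ) {ω : Config} {x y z : Site} (hy : y ∉ box L x)
    (hz : z ∉ box L x) (h : Joined (ω ∪ enhAt φ x ω) y z) : Joined ω y z := by
  have hbox : ∀ {u : Site}, u ∉ box L x → u - x ∉ box L 0 := fun {u} hu => by
    simp only [mem_box, Prod.fst_zero, Prod.snd_zero, Prod.fst_sub, Prod.snd_sub] at hu ⊢
    omega
  have h' := h.shift_sub x
  rw [shiftConfig_union_enhAt] at h'
  suffices Joined (shiftConfig x ω) (y - x) (z - x) by simpa using this.shift x
  by_contra hcon
  obtain ⟨n, c, h0, hn, hc, hadj⟩ := h'.exists_walk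
  refine false_of_escape hsub hloc hness (C := {u | Joined (shiftConfig x ω) (y - x) u})
    (fun u hu v hv huv => ⟨hu.1, hu.2.tail ⟨huv, hv⟩⟩) hc hadj ?_ ?_
  · rw [h0]
    exact ⟨⟨h'.1.resolve_right fun h => hbox hy (hsub _ h), .refl⟩, hbox hy⟩
  · rw [hn]
    exact fun h => h.elim hcon (hbox hz)

lemma Joined.of_finset_enhAt (hmono : Monotonic φ) (hsub : ∀ ω, φ ω ⊆ box L 0)
    (hloc : ∀ ω ω' : Config, ω ∩ box L 0 = ω' ∩ box L 0 → φ ω = φ ω')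
    (hness : ¬ Essential adjZ2 φ) {ω : Config} {y z : Site} (X : Finset Site)
    (hX : ∀ x ∈ X, y ∉ box L x ∧ z ∉ box L x)
    (h : Joined (ω ∪ ⋃ x ∈ X, enhAt φ x ω) y z) : Joined ω y z := by
  classical
  induction X using Finset.induction_on with
  | empty => simpa using h
  | insert x X _ ih =>
    refine ih (fun u hu => hX u (Finset.mem_insert_of_mem hu)) ?_
    have hx := hX x (Finset.mem_insert_self x X)
    refine Joined.of_union_enhAt hsub hloc hness hx.1 hx.2 (h.mono ?_)
    rw [Finset.set_biUnion_insert]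
    rintro v (hv | hv | hv)
    · exact Or.inl (Or.inl hv)
    · exact Or.inr (enhAt_mono hmono x subset_union_left hv)
    · exact Or.inl (Or.inr hv)

lemma Joined.exists_finset {ω : Config} {y z : Site} (h : Joined (fullyEnhanced φ ω) y z) :
    ∃ X : Finset Site, Joined (ω ∪ ⋃ x ∈ X, enhAt φ x ω) y z := by
  classical
  have hmem : ∀ {v}, v ∈ fullyEnhanced φ ω →
      ∃ X : Finset Site, v ∈ ω ∪ ⋃ x ∈ X, enhAt φ x ω := by
    rintro v (hv | ⟨x, hv⟩)
    · exact ⟨∅, Or.inl hv⟩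
    · exact ⟨{x}, Or.inr (by simpa using hv)⟩
  obtain ⟨hy, h⟩ := h
  induction h with
  | refl =>
    obtain ⟨X, hX⟩ := hmem hy
    exact ⟨X, hX, .refl⟩
  | @tail u v _ h ih =>
    obtain ⟨X, hX⟩ := ih
    obtain ⟨Y, hY⟩ := hmem h.2
    have hmono : ∀ {Z : Finset Site}, Z ⊆ X ∪ Y →
        ω ∪ ⋃ x ∈ Z, enhAt φ x ω ⊆ ω ∪ ⋃ x ∈ X ∪ Y, enhAt φ x ω := fun hZ =>
      Set.union_subset_union_right _ (Set.biUnion_subset_biUnion_left fun _ hx => hZ hx)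
    have hX' := hX.mono (hmono Finset.subset_union_left)
    exact ⟨X ∪ Y, hX'.1, hX'.2.tail ⟨h.1, hmono Finset.subset_union_right hY⟩⟩

/-- Only the enhancements near the end points matter for a connection. -/
lemma Joined.of_fullyEnhanced (hmono : Monotonic φ) (hsub : ∀ ω, φ ω ⊆ box L 0)
    (hloc : ∀ ω ω' : Config, ω ∩ box L 0 = ω' ∩ box L 0 → φ ω = φ ω')
    (hness : ¬ Essential adjZ2 φ) {ω : Config} {y z : Site}
    (h : Joined (fullyEnhanced φ ω) y z) :
    Joined (ω ∪ ⋃ x ∈ box L y ∪ box L z, enhAt φ x ω) y z := by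
  classical
  obtain ⟨X, hX⟩ := h.exists_finset
  refine Joined.of_finset_enhAt hmono hsub hloc hness
    (X.filter fun x => x ∉ box L y ∪ box L z) (fun x hx => ?_) (hX.mono ?_)
  · have := (Finset.mem_filter.1 hx).2
    rw [Set.mem_union, not_or, mem_box_comm, mem_box_comm (c := z)] at this
    exact this
  · rintro v (hv | hv)
    · exact Or.inl (Or.inl hv)
    · simp only [Set.mem_iUnion, exists_prop] at hv
      obtain ⟨x, hxX, hv⟩ := hv
      by_cases hx : x ∈ box L y ∪ box L z
      · exact Or.inl (Or.inr (Set.mem_biUnion hx hv))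
      · refine Or.inr (Set.mem_biUnion (Finset.mem_coe.2 (Finset.mem_filter.2 ⟨hxX, hx⟩)) ?_)
        exact enhAt_mono hmono x subset_union_left hv

/-- An infinite cluster of the enhanced configuration forces an infinite cluster of the
original one nearby. -/
lemma exists_inInfiniteCluster (hL : 0 ≤ L) (hmono : Monotonic φ) (hsub : ∀ ω, φ ω ⊆ box L 0)
    (hloc : ∀ ω ω' : Config, ω ∩ box L 0 = ω' ∩ box L 0 → φ ω = φ ω')
    (hness : ¬ Essential adjZ2 φ) {ω : Config}
    (h : InInfiniteCluster adjZ2 (fullyEnhanced φ ω) 0) :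
    ∃ u ∈ box (2 * L + 1) 0, InInfiniteCluster adjZ2 ω u := by
  by_contra! hcon
  have hstep : ∀ {u v w : Site}, u ∈ box (2 * L) w → adjZ2 u v → v ∈ box (2 * L + 1) w := by
    intro u v w hu huv
    rw [adjZ2_iff] at huv
    simp only [mem_box] at hu ⊢
    omega
  set D : Set Site := ⋃ u ∈ box (2 * L + 1) 0, {y | ConnectedIn adjZ2 ω u y} with hD
  have hDfin : D.Finite := (box_finite _ _).biUnion fun u hu => Set.not_infinite.1 (hcon u hu)
  have hFfin : (⋃ v ∈ D ∪ box (2 * L) 0, box (2 * L + 1) v).Finite :=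
    (hDfin.union (box_finite _ _)).biUnion fun v _ => box_finite _ v
  obtain ⟨w, hw, hwF⟩ := h.exists_notMem_finite hFfin
  have hfar : ∀ v ∈ D ∪ box (2 * L) 0, v ∉ box (2 * L + 1) w := fun v hv hvw =>
    hwF (Set.mem_biUnion hv (mem_box_comm.1 hvw))
  have hj := (joined_iff_connectedIn.2 hw).of_fullyEnhanced hmono hsub hloc hness
  have hwS : w ∈ D ∪ box (2 * L) 0 := by
    refine hj.mem_of_closed ?_ (Or.inr ?_)
    · rintro u hu v (hv | hv) huv
      · rcases hu with hu | hu
        · simp only [hD, Set.mem_iUnion, exists_prop] at hu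
          obtain ⟨t, ht, hu⟩ := hu
          have hu' := joined_iff_connectedIn.2 hu
          exact Or.inl (Set.mem_biUnion ht
            (joined_iff_connectedIn.1 ⟨hu'.1, hu'.2.tail ⟨huv, hv⟩⟩))
        · exact Or.inl (Set.mem_biUnion (hstep hu huv) (joined_iff_connectedIn.1 ⟨hv, .refl⟩))
      · simp only [Set.mem_iUnion, exists_prop] at hv
        obtain ⟨x, hx, hv⟩ := hv
        have hvx := enhAt_subset_box hsub x ω hv
        rcases hx with hx | hx
        · right
          simp only [mem_box] at hvx hx ⊢
          omega
        · refine absurd (hstep (w := w) ?_ huv.symm) (hfar u hu)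
          simp only [mem_box] at hvx hx ⊢
          omega
    · simp only [mem_box, Prod.fst_zero, Prod.snd_zero]; omega
  refine hfar w hwS ?_
  simp only [mem_box]; omega

end Deterministic

lemma InInfiniteCluster.mono {ω ω' : Config} (hω : ω ⊆ ω') {x : Site}
    (h : InInfiniteCluster adjZ2 ω x) : InInfiniteCluster adjZ2 ω' x :=
  Set.Infinite.mono (fun _ hy => joined_iff_connectedIn.1 ((joined_iff_connectedIn.2 hy).mono hω)) h

lemma InInfiniteCluster.shift {ω : Config} {x : Site} (h : InInfiniteCluster adjZ2 ω x) :
    InInfiniteCluster adjZ2 (shiftConfig x ω) 0 := by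
  refine Set.infinite_of_injOn_mapsTo (f := (· - x)) (sub_left_injective.injOn) (fun y hy => ?_) h
  have := (joined_iff_connectedIn.2 hy).shift_sub x
  rw [sub_self] at this
  exact joined_iff_connectedIn.1 this

lemma cylinder_eq_restrict_preimage (F : Finset Site) (b : Site → Bool) :
    cylinder F b = (F.restrict : (Site → Bool) → (F → Bool)) ⁻¹' {F.restrict b} := by
  ext η
  simp only [cylinder, Set.mem_ofPred_eq, Set.mem_preimage, Set.mem_singleton_iff, funext_iff,
    Finset.restrict, Subtype.forall]

lemma IsBernoulli.unique {p : ℝ} {μ ν : Measure (Site → Bool)} (hμ : IsBernoulli p μ)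
    (hν : IsBernoulli p ν) : μ = ν := by
  have := hμ.1
  have := hν.1
  refine IsProjectiveLimit.unique (P := fun F : Finset Site => μ.map F.restrict)
    (fun _ => rfl) fun F => ?_
  refine Measure.ext_of_singleton fun b => ?_
  obtain ⟨b, rfl⟩ : ∃ b' : Site → Bool, F.restrict b' = b :=
    ⟨fun x => if hx : x ∈ F then b ⟨x, hx⟩ else true, by ext x; simp⟩
  rw [Measure.map_apply (Finset.measurable_restrict F) (measurableSet_singleton _),
    Measure.map_apply (Finset.measurable_restrict F) (measurableSet_singleton _),
    ← cylinder_eq_restrict_preimage, hμ.2, hν.2]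

/-- Translation of Bernoulli configurations. -/
def shiftEquiv (x : Site) : (Site → Bool) ≃ᵐ (Site → Bool) where
  toFun η y := η (y + x)
  invFun η y := η (y - x)
  left_inv η := by ext y; simp
  right_inv η := by ext y; simp
  measurable_toFun := measurable_pi_iff.2 fun y => measurable_pi_apply (y + x)
  measurable_invFun := measurable_pi_iff.2 fun y => measurable_pi_apply (y - x)

lemma IsBernoulli.map_shiftEquiv {p : ℝ} {μ : Measure (Site → Bool)} (hμ : IsBernoulli p μ)
    (x : Site) : μ.map (shiftEquiv x) = μ := by
  have := hμ.1
  refine IsBernoulli.unique (p := p)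
    ⟨Measure.isProbabilityMeasure_map (shiftEquiv x).measurable.aemeasurable, fun F b => ?_⟩ hμ
  rw [MeasurableEquiv.map_apply]
  have : shiftEquiv x ⁻¹' cylinder F b =
      cylinder (F.map (Equiv.addRight x).toEmbedding) fun y => b (y - x) := by
    ext η
    simp only [cylinder, Set.mem_preimage, Set.mem_ofPred_eq, Finset.forall_mem_map]
    refine forall₂_congr fun y _ => ?_
    change η (y + x) = b y ↔ η (y + x) = b (y + x - x)
    rw [add_sub_cancel_right]
  rw [this, hμ.2, Finset.prod_map]
  simp

lemma IsBernoulli.measure_inInfiniteCluster_le {p : ℝ} {μ : Measure (Site → Bool)}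
    (hμ : IsBernoulli p μ) (x : Site) :
    μ {η | InInfiniteCluster adjZ2 (toConfig η) x} ≤
      μ {η | InInfiniteCluster adjZ2 (toConfig η) 0} := by
  conv_rhs => rw [← hμ.map_shiftEquiv x, MeasurableEquiv.map_apply]
  exact measure_mono fun η hη => InInfiniteCluster.shift hη

/-- for a monotonic nonessential enhancement there is a constant
`c₁ ∈ (0,∞)`, depending only on the enhancement, such that for all `s ∈ [0,1]` and
`p ∈ (p_c, 1]`: `θ(p) ≤ θ(p,s) ≤ c₁ · θ(p)`. -/
theorem theta_comparison
    (P : ℝ → Measure (Site → Bool))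
    (hP : ∀ p ∈ Icc (0:ℝ) 1, IsBernoulli p (P p))
    (R₀ : ℝ) (φ : Config → Config) (hφ : IsEnhancement R₀ φ)
    (hmono : Monotonic φ) (hness : ¬ Essential adjZ2 φ) :
    ∃ c₁ : ℝ, 0 < c₁ ∧
      ∀ s ∈ Icc (0:ℝ) 1, ∀ p : ℝ, pcOf adjZ2 P < p → p ≤ 1 →
        theta adjZ2 (P p) ≤ thetaEnh adjZ2 φ (P p) (P s) ∧
          thetaEnh adjZ2 φ (P p) (P s) ≤ c₁ * theta adjZ2 (P p) := by
  have hR : siteBall R₀ ⊆ box ⌈R₀⌉₊ 0 := siteBall_subset_box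
  set L : ℤ := (⌈R₀⌉₊ : ℤ)
  have hL : 0 ≤ L := Int.natCast_nonneg _
  have hsub : ∀ ω, φ ω ⊆ box L 0 := fun ω => (hφ.2.1 ω).trans hR
  have hloc : ∀ ω ω' : Config, ω ∩ box L 0 = ω' ∩ box L 0 → φ ω = φ ω' := fun ω ω' h =>
    hφ.2.2 ω ω' (by
      rw [← Set.inter_eq_self_of_subset_right hR, ← Set.inter_assoc, h, Set.inter_assoc])
  set B : Finset Site := (box_finite (2 * L + 1) 0).toFinset
  have hB : (0 : Site) ∈ B := by
    simp only [B, Set.Finite.mem_toFinset, mem_box, Prod.fst_zero, Prod.snd_zero]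
    omega
  refine ⟨B.card, by exact_mod_cast Finset.card_pos.2 ⟨0, hB⟩, fun s hs p hp hp1 => ?_⟩
  have hp0 : 0 ≤ p := (Real.sSup_nonneg fun q hq => hq.1.1).trans hp.le
  have hμ := hP p ⟨hp0, hp1⟩
  have := hμ.1
  have := (hP s hs).1
  have hfst (A : Set (Site → Bool)) : ((P p).prod (P s)) (A ×ˢ univ) = P p A := by
    rw [Measure.prod_prod, measure_univ, mul_one]
  unfold theta thetaEnh
  constructor
  · rw [← hfst]
    refine ENNReal.toReal_mono (measure_ne_top _ _) (measure_mono ?_)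
    rintro ⟨η, α⟩ ⟨h, -⟩
    exact InInfiniteCluster.mono subset_union_left h
  · rw [← ENNReal.toReal_natCast, ← ENNReal.toReal_mul]
    refine ENNReal.toReal_mono (ENNReal.mul_ne_top (by simp) (measure_ne_top _ _)) ?_
    calc ((P p).prod (P s))
          {ηα | InInfiniteCluster adjZ2 (enhanced φ (toConfig ηα.1) ηα.2) 0}
        ≤ ((P p).prod (P s))
          ((⋃ u ∈ B, {η | InInfiniteCluster adjZ2 (toConfig η) u}) ×ˢ univ) := by
          refine measure_mono fun ⟨η, α⟩ h => ⟨?_, Set.mem_univ _⟩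
          have hle : enhanced φ (toConfig η) α ⊆ fullyEnhanced φ (toConfig η) :=
            Set.union_subset_union_right _ fun y ⟨x, _, hy⟩ => ⟨x, hy⟩
          obtain ⟨u, hu, hinf⟩ := exists_inInfiniteCluster hL hmono hsub hloc hness
            (InInfiniteCluster.mono hle h)
          exact Set.mem_biUnion (by simpa [B] using hu) hinf
      _ = P p (⋃ u ∈ B, {η | InInfiniteCluster adjZ2 (toConfig η) u}) := hfst _
      _ ≤ ∑ u ∈ B, P p {η | InInfiniteCluster adjZ2 (toConfig η) u} :=
          measure_biUnion_finset_le _ _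
      _ ≤ ∑ _u ∈ B, P p {η | InInfiniteCluster adjZ2 (toConfig η) 0} :=
          Finset.sum_le_sum fun u _ => hμ.measure_inInfiniteCluster_le u
      _ = B.card * P p {η | InInfiniteCluster adjZ2 (toConfig η) 0} := by
          rw [Finset.sum_const, nsmul_eq_mul]

end PercEnh
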